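/- Let V and E be finite types and let ι : E × Bool → V be any map (the flag-to-vertex incidence map of a graph with edge set E, vertex set V, where the two flags of an edge e are (e,false) and (e,true)). Let A be the free abelian group on the set of flags E × Bool and let N ≤ A be the subgroup generated by the elements of(e,false) + of(e,true) for every edge e ∈ E, together with the elements ∑_{f : ι f = v} of f for every vertex v ∈ V. Let B be the free abelian group on E and let M ≤ B be the subgroup generated by the elements ∑_{e : ι(e,false) = v} of e − ∑_{e : ι(e,true) = v} of e for every vertex v ∈ V. Then the homomorphism A → B/M sending of(e,false) to the class of of e and of(e,true) to the class of −(of e) kills N and induces an isomorphism of abelian groups A ⧸ N ≅ B ⧸ M (hence an isomorphism of the corresponding integral group rings ℤ[A⧸N] ≅ ℤ[B⧸M]). -/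

import Mathlib

/-- Identification of the flag-generated group `A ⧸ N` with the edge-generated group
`B ⧸ M` for a graph with vertex set `V`, edge set `E` and flag-to-vertex incidence map
`ι : E × Bool → V`.  Here `A` is the free abelian group on the flags, `N` is generated
by `of(e,false) + of(e,true)` for each edge and by `∑_{f : ι f = v} of f` for each
vertex; `B` is the free abelian group on the edges and `M` is generated by
`∑_{e : ι(e,false) = v} of e - ∑_{e : ι(e,true) = v} of e` for each vertex.  The
homomorphism `A → B ⧸ M` sending `of(e,false) ↦ [of e]` and `of(e,true) ↦ [-of e]`
kills `N` and induces an isomorphism `A ⧸ N ≃ B ⧸ M`, hence an isomorphism of the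
corresponding integral group rings. -/
theorem flag_ring_iso_edge_ring {V E : Type*} [Fintype V] [Fintype E]
    [DecidableEq V] [DecidableEq E] (ι : E × Bool → V)
    (N : AddSubgroup ((E × Bool) →₀ ℤ))
    (hN : N = AddSubgroup.closure
      ((Set.range fun e : E =>
          Finsupp.single ((e, false) : E × Bool) (1 : ℤ) + Finsupp.single (e, true) 1) ∪
       (Set.range fun v : V =>
          ∑ f : E × Bool, if ι f = v then Finsupp.single f (1 : ℤ) else 0)))
    (M : AddSubgroup (E →₀ ℤ))
    (hM : M = AddSubgroup.closure
      (Set.range fun v : V =>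
        (∑ e : E, if ι (e, false) = v then Finsupp.single e (1 : ℤ) else 0) -
        (∑ e : E, if ι (e, true) = v then Finsupp.single e (1 : ℤ) else 0)))
    (φ : ((E × Bool) →₀ ℤ) →+ (E →₀ ℤ) ⧸ M)
    (hφ : ∀ e : E,
      φ (Finsupp.single ((e, false) : E × Bool) 1) =
          (QuotientAddGroup.mk (Finsupp.single e 1) : (E →₀ ℤ) ⧸ M) ∧
      φ (Finsupp.single ((e, true) : E × Bool) 1) =
          (QuotientAddGroup.mk (-Finsupp.single e 1) : (E →₀ ℤ) ⧸ M)) :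
    N ≤ φ.ker ∧
    ∃ ψ : (((E × Bool) →₀ ℤ) ⧸ N) ≃+ ((E →₀ ℤ) ⧸ M),
      (∀ a : (E × Bool) →₀ ℤ, ψ (QuotientAddGroup.mk a) = φ a) ∧
      ∃ ρ : AddMonoidAlgebra ℤ (((E × Bool) →₀ ℤ) ⧸ N)
              ≃+* AddMonoidAlgebra ℤ ((E →₀ ℤ) ⧸ M),
        ∀ x, ρ (AddMonoidAlgebra.single x 1) = AddMonoidAlgebra.single (ψ x) 1 := by
  have hker : N ≤ φ.ker := by
    rw [hN, AddSubgroup.closure_le]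
    rintro _ (⟨e, rfl⟩ | ⟨v, rfl⟩)
    · simp [(hφ e).1, (hφ e).2]
    · have hv : (QuotientAddGroup.mk
          ((∑ e : E, if ι (e, false) = v then Finsupp.single e (1 : ℤ) else 0) -
          (∑ e : E, if ι (e, true) = v then Finsupp.single e (1 : ℤ) else 0)) :
          (E →₀ ℤ) ⧸ M) = 0 := by
        rw [QuotientAddGroup.eq_zero_iff, hM]
        exact AddSubgroup.subset_closure ⟨v, rfl⟩
      change φ _ = 0
      rw [← hv, ← QuotientAddGroup.mk'_apply, map_sub, map_sum, map_sum, map_sum,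
        Fintype.sum_prod_type, ← Finset.sum_sub_distrib]
      refine Finset.sum_congr rfl fun e _ => ?_
      rw [Fintype.sum_bool, add_comm, sub_eq_add_neg]
      congr 1
      · split_ifs
        · exact (hφ e).1
        · simp
      · split_ifs
        · exact (hφ e).2
        · simp
  have hflag : ∀ e : E, (QuotientAddGroup.mk' N (Finsupp.single ((e, true) : E × Bool) 1)) =
      - QuotientAddGroup.mk' N (Finsupp.single ((e, false) : E × Bool) 1) := by
    intro e
    rw [eq_neg_iff_add_eq_zero, add_comm, ← map_add, QuotientAddGroup.mk'_apply,
      QuotientAddGroup.eq_zero_iff, hN]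
    exact AddSubgroup.subset_closure (Or.inl ⟨e, rfl⟩)
  let g : (E →₀ ℤ) →+ (((E × Bool) →₀ ℤ) ⧸ N) :=
    (QuotientAddGroup.mk' N).comp (Finsupp.mapDomain.addMonoidHom fun e : E => (e, false))
  have hg : ∀ e : E, g (Finsupp.single e 1) =
      QuotientAddGroup.mk' N (Finsupp.single ((e, false) : E × Bool) 1) := by
    intro e
    simp [g, Finsupp.mapDomain_single]
  have hgker : M ≤ g.ker := by
    rw [hM, AddSubgroup.closure_le]
    rintro _ ⟨v, rfl⟩
    have hv : QuotientAddGroup.mk' N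
        (∑ f : E × Bool, if ι f = v then Finsupp.single f (1 : ℤ) else 0) = 0 := by
      rw [QuotientAddGroup.mk'_apply, QuotientAddGroup.eq_zero_iff, hN]
      exact AddSubgroup.subset_closure (Or.inr ⟨v, rfl⟩)
    change g _ = 0
    rw [← hv, map_sub, map_sum, map_sum, map_sum,
      Fintype.sum_prod_type, ← Finset.sum_sub_distrib]
    refine Finset.sum_congr rfl fun e _ => ?_
    rw [Fintype.sum_bool, add_comm, sub_eq_add_neg]
    congr 1
    · split_ifs
      · exact hg e
      · simp
    · split_ifs
      · rw [hg, hflag]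
      · simp
  let F := QuotientAddGroup.lift N φ hker
  let G := QuotientAddGroup.lift M g hgker
  have hGF : G.comp F = AddMonoidHom.id _ := by
    apply QuotientAddGroup.addMonoidHom_ext
    apply Finsupp.addHom_ext'
    rintro ⟨e, b⟩
    apply AddMonoidHom.ext_int
    change G (φ (Finsupp.single (e, b) 1)) = QuotientAddGroup.mk' N (Finsupp.single (e, b) 1)
    cases b
    · rw [(hφ e).1]
      exact hg e
    · rw [(hφ e).2, hflag, ← hg, ← map_neg]
      rfl
  have hFG : F.comp G = AddMonoidHom.id _ := by
    apply QuotientAddGroup.addMonoidHom_ext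
    apply Finsupp.addHom_ext'
    intro e
    apply AddMonoidHom.ext_int
    change F (g (Finsupp.single e 1)) = QuotientAddGroup.mk (Finsupp.single e 1)
    rw [hg]
    exact (hφ e).1
  refine ⟨hker, AddMonoidHom.toAddEquiv F G hGF hFG, fun a => rfl, ?_⟩
  refine ⟨AddMonoidAlgebra.mapDomainRingEquiv ℤ (AddMonoidHom.toAddEquiv F G hGF hFG), ?_⟩
  intro x
  simp
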